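/- There exists a constant M₀ ∈ (0,∞), depending only on τ, N₁ and N₂, such that for every ε > 0 and every solution u of (E_ε) one has ∫_Ω ε^{-2} | e^u (1−e^u) / (τ+e^u)³ | dx ≤ M₀. -/

import Mathlib

open MeasureTheory Real Filter Set Metric Topology

noncomputable section

/-- The Euclidean plane `ℝ²`. -/
abbrev Pl := EuclideanSpace ℝ (Fin 2)

/-- The unit lattice `ℤ² ⊆ ℝ²`; the flat 2-torus `Ω` is its quotient, which we model by
working with doubly periodic functions on the plane. -/
def unitLattice : Set Pl :=
  {v | ∃ a b : ℤ, v = (a : ℝ) • EuclideanSpace.single 0 (1:ℝ) +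
      (b : ℝ) • EuclideanSpace.single 1 (1:ℝ)}

/-- A fundamental domain for the torus `Ω` (of total area `|Ω| = 1`). -/
def fund : Set Pl := {x | x 0 ∈ Ico (0:ℝ) 1 ∧ x 1 ∈ Ico (0:ℝ) 1}

/-- A doubly periodic function on the plane, i.e. a function on the torus `Ω`. -/
def Periodic2 (u : Pl → ℝ) : Prop := ∀ x : Pl, ∀ v ∈ unitLattice, u (x + v) = u x

/-- Partial derivative in the `i`-th coordinate direction. -/
def pd (u : Pl → ℝ) (i : Fin 2) : Pl → ℝ :=
  fun x => lineDeriv ℝ u x (EuclideanSpace.single i (1:ℝ))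

/-- The Laplacian `Δu`. -/
def lap (u : Pl → ℝ) (x : Pl) : ℝ := pd (pd u 0) 0 x + pd (pd u 1) 1 x

/-- `|∇u|²`. -/
def gradSq (u : Pl → ℝ) (x : Pl) : ℝ := (pd u 0 x) ^ 2 + (pd u 1 x) ^ 2

/-- The nonlinearity `f_τ(t) = e^t (1 − e^t) / (τ + e^t)³`. -/
def fτ (τ t : ℝ) : ℝ := exp t * (1 - exp t) / (τ + exp t) ^ 3

/-- `f_τ'(t) = e^t (τ − 2(τ+1) e^t + e^{2t}) / (τ + e^t)⁴`. -/
def fτ' (τ t : ℝ) : ℝ := exp t * (τ - 2 * (τ + 1) * exp t + exp (2 * t)) / (τ + exp t) ^ 4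

/-- The antiderivative `F_{2,τ}(t) = e^t ((1−τ) e^t + 2τ) / (2τ² (τ+e^t)²)` of `f_τ`. -/
def F2τ (τ t : ℝ) : ℝ := exp t * ((1 - τ) * exp t + 2 * τ) / (2 * τ ^ 2 * (τ + exp t) ^ 2)

/-- `u − 2a ln‖· − p‖` extends smoothly across `p`: this encodes the distributional
equation `Δu = 4πa δ_p + (smooth)` near `p`. -/
def LogSing (u : Pl → ℝ) (p : Pl) (a : ℝ) : Prop :=
  ∃ r > 0, ∃ v : Pl → ℝ, ContDiffOn ℝ (⊤ : ℕ∞) v (ball p r) ∧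
    ∀ x ∈ ball p r, x ≠ p → u x = 2 * a * Real.log ‖x - p‖ + v x

/-- The vortex data: distinct points `p_{j,1}` (`1 ≤ j ≤ d₁`), `p_{j,2}` (`1 ≤ j ≤ d₂`)
of the torus with multiplicities `m_{j,1} ≥ 0`, `m_{j,2} ≥ 0`. -/
structure VortexData where
  d₁ : ℕ
  d₂ : ℕ
  p₁ : Fin d₁ → Pl
  p₂ : Fin d₂ → Pl
  m₁ : Fin d₁ → ℝ
  m₂ : Fin d₂ → ℝ
  m₁_nonneg : ∀ j, 0 ≤ m₁ j
  m₂_nonneg : ∀ j, 0 ≤ m₂ j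
  distinct : ∀ i j : Fin d₁ ⊕ Fin d₂, i ≠ j → ∀ v ∈ unitLattice,
      Sum.elim p₁ p₂ i ≠ Sum.elim p₁ p₂ j + v

namespace VortexData
variable (V : VortexData)

/-- The set `Z₁` of vortex points `p_{j,1}` (viewed in the plane: all lattice translates). -/
def Z1 : Set Pl := {x | ∃ j v, v ∈ unitLattice ∧ x = V.p₁ j + v}

/-- The set `Z₂` of vortex points `p_{j,2}` (viewed in the plane: all lattice translates). -/
def Z2 : Set Pl := {x | ∃ j v, v ∈ unitLattice ∧ x = V.p₂ j + v}

/-- The full vortex set `Z = Z₁ ∪ Z₂`. -/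
def Z : Set Pl := V.Z1 ∪ V.Z2

/-- `N₁ = Σ_j m_{j,1}`. -/
def N1 : ℝ := ∑ j, V.m₁ j

/-- `N₂ = Σ_j m_{j,2}`. -/
def N2 : ℝ := ∑ j, V.m₂ j

end VortexData

/-- `u` is a solution of `(E_ε)`:
`Δu + ε⁻² f_τ(u) = 4π Σ_j m_{j,1} δ_{p_{j,1}} − 4π Σ_j m_{j,2} δ_{p_{j,2}}` on `Ω`,
formulated classically: `u` is doubly periodic, smooth away from `Z`, solves the PDE
classically off `Z`, and has the prescribed logarithmic singularities at the vortices. -/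
structure IsSolution (V : VortexData) (τ ε : ℝ) (u : Pl → ℝ) : Prop where
  periodic : Periodic2 u
  smooth : ContDiffOn ℝ (⊤ : ℕ∞) u (V.Z)ᶜ
  pde : ∀ x ∉ V.Z, lap u x + (ε ^ 2)⁻¹ * fτ τ (u x) = 0
  sing₁ : ∀ j, LogSing u (V.p₁ j) (V.m₁ j)
  sing₂ : ∀ j, LogSing u (V.p₂ j) (-(V.m₂ j))

/-- The quadratic form `∫_Ω |∇φ|² − ε⁻² f_τ'(u) φ²` of the linearized operator at `u`. -/
def QuadForm (τ ε : ℝ) (u φ : Pl → ℝ) : ℝ :=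
  ∫ x in fund, (gradSq φ x - (ε ^ 2)⁻¹ * fτ' τ (u x) * (φ x) ^ 2)

/-- `u` is a stable solution: the first eigenvalue `μ_ε` of the linearized operator is
nonnegative, i.e. the quadratic form is nonnegative on all (smooth, doubly periodic)
test functions. -/
def Stable (τ ε : ℝ) (u : Pl → ℝ) : Prop :=
  ∀ φ : Pl → ℝ, ContDiff ℝ (⊤ : ℕ∞) φ → Periodic2 φ → 0 ≤ QuadForm τ ε u φ

/-- `u` is strictly stable: the first eigenvalue `μ_ε` of the linearized operator is
strictly positive. -/
def StrictlyStable (τ ε : ℝ) (u : Pl → ℝ) : Prop :=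
  ∃ μ > 0, ∀ φ : Pl → ℝ, ContDiff ℝ (⊤ : ℕ∞) φ → Periodic2 φ →
    μ * (∫ x in fund, (φ x) ^ 2) ≤ QuadForm τ ε u φ

theorem pd_eq_fderiv {u : Pl → ℝ} {x : Pl} (h : DifferentiableAt ℝ u x) (i : Fin 2) :
    pd u i x = fderiv ℝ u x (EuclideanSpace.single i (1:ℝ)) := h.lineDeriv_eq_fderiv

theorem measurableSet_fund : MeasurableSet fund := by
  have h0 : Measurable (fun x : Pl => x 0) := by fun_prop
  have h1 : Measurable (fun x : Pl => x 1) := by fun_prop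
  exact (h0 measurableSet_Ico).inter (h1 measurableSet_Ico)

theorem fund_eq : fund = WithLp.ofLp (p := 2) (V := Fin 2 → ℝ) ⁻¹'
    (Set.pi univ fun _ : Fin 2 => Ico (0:ℝ) 1) := by
  ext x
  simp [fund, Set.mem_pi, Fin.forall_fin_two]

theorem fund_setIntegral (F : Pl → ℝ) :
    ∫ x in fund, F x = ∫ y in Icc (0 : Fin 2 → ℝ) 1, F (WithLp.toLp 2 y) := by
  have h := (PiLp.volume_preserving_ofLp (Fin 2)).setIntegral_preimage_emb
    (MeasurableEquiv.toLp 2 (Fin 2 → ℝ)).symm.measurableEmbedding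
    (fun y => F (WithLp.toLp 2 y)) (Set.pi univ fun _ : Fin 2 => Ico (0:ℝ) 1)
  rw [fund_eq]
  refine h.trans ?_
  exact setIntegral_congr_set (Measure.univ_pi_Ico_ae_eq_Icc (f := (0 : Fin 2 → ℝ)) (g := 1))

theorem fund_subset_ball : fund ⊆ closedBall (0:Pl) 2 := by
  intro x hx
  rw [mem_closedBall_zero_iff, EuclideanSpace.norm_eq, Real.sqrt_le_left (by norm_num)]
  simp only [Fin.sum_univ_two, Real.norm_eq_abs, sq_abs]
  obtain ⟨⟨a, b⟩, c, d⟩ := hx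
  nlinarith

theorem fund_volume_lt_top : volume fund < ⊤ :=
  lt_of_le_of_lt (measure_mono fund_subset_ball) measure_closedBall_lt_top

theorem continuous_integrableOn_fund {F : Pl → ℝ} (hF : Continuous F) : IntegrableOn F fund :=
  (hF.continuousOn.integrableOn_compact (isCompact_closedBall (0:Pl) 2)).mono_set fund_subset_ball

theorem single_mem_unitLattice (i : Fin 2) : EuclideanSpace.single i (1:ℝ) ∈ unitLattice := by
  fin_cases i
  · exact ⟨1, 0, by simp⟩
  · exact ⟨0, 1, by simp⟩

theorem continuous_pd {F : Pl → ℝ} (hF : ContDiff ℝ 1 F) (i : Fin 2) : Continuous (pd F i) := by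
  have : pd F i = fun x => fderiv ℝ F x (EuclideanSpace.single i (1:ℝ)) := by
    ext x
    exact pd_eq_fderiv (hF.differentiable (by norm_num) x) i
  rw [this]
  exact (hF.continuous_fderiv (by norm_num)).clm_apply continuous_const

theorem integral_div_eq_zero (X : Fin 2 → Pl → ℝ) (hX : ∀ i, ContDiff ℝ 1 (X i))
    (hp : ∀ i, Periodic2 (X i)) :
    ∫ x in fund, (pd (X 0) 0 x + pd (X 1) 1 x) = 0 := by
  rw [fund_setIntegral]
  let L : (Fin 2 → ℝ) →L[ℝ] Pl := (PiLp.continuousLinearEquiv 2 ℝ (fun _ : Fin 2 => ℝ)).symm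
  have hL : ∀ y, L y = WithLp.toLp 2 y := fun y => rfl
  have hd : ∀ i x, DifferentiableAt ℝ (X i) x := fun i x => (hX i).differentiable (by norm_num) x
  have key := integral_divergence_of_hasFDerivAt_off_countable' (n := 1) (0 : Fin 2 → ℝ) 1
    (by intro i; simp) (fun i y => X i (L y)) (fun i y => (fderiv ℝ (X i) (L y)).comp L) ∅
    countable_empty
    (fun i => ((hX i).continuous.comp L.continuous).continuousOn)
    (fun y _ i => (hd i (L y)).hasFDerivAt.comp y L.hasFDerivAt)
    (by
      refine Continuous.integrableOn_Icc ?_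
      refine continuous_finsetSum _ fun i _ => ?_
      exact (((hX i).continuous_fderiv (by norm_num)).comp L.continuous).clm_apply
        continuous_const)
  have e : ∀ y : Fin 2 → ℝ, pd (X 0) 0 (WithLp.toLp 2 y) + pd (X 1) 1 (WithLp.toLp 2 y)
      = ∑ i : Fin 2, ((fderiv ℝ (X i) (L y)).comp L) (Pi.single i 1) := by
    intro y
    rw [Fin.sum_univ_two, pd_eq_fderiv (hd _ _), pd_eq_fderiv (hd _ _)]
    rfl
  simp_rw [e]
  refine key.trans (Finset.sum_eq_zero fun i _ => ?_)
  rw [sub_eq_zero]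
  congr 1
  ext x
  have := hp i (L (i.insertNth 0 x)) _ (single_mem_unitLattice i)
  simp only [Pi.one_apply, Pi.zero_apply]
  rw [← this]
  congr 1
  ext k
  rw [PiLp.add_apply, hL, hL]
  fin_cases i <;> fin_cases k <;> simp
  rfl

/-! ### The periodic squared distance -/

/-- Smooth doubly periodic function vanishing exactly at the lattice translates of `p`. -/
def rho (p x : Pl) : ℝ := sin (π * (x 0 - p 0)) ^ 2 + sin (π * (x 1 - p 1)) ^ 2

theorem rho_nonneg (p x : Pl) : 0 ≤ rho p x := by unfold rho; positivity

theorem rho_contDiff (p : Pl) : ContDiff ℝ 1 (rho p) := by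
  unfold rho
  fun_prop

theorem sin_sq_add_int (t : ℝ) (n : ℤ) : sin (π * (t + n)) ^ 2 = sin (π * t) ^ 2 := by
  rw [mul_add, mul_comm π (n:ℝ), Real.sin_add_int_mul_pi, mul_pow]
  rcases neg_one_pow_eq_or ℝ n.natAbs with h | h <;>
  rcases Int.even_or_odd n with h' | h' <;> simp [h'.neg_one_zpow]

theorem rho_periodic (p : Pl) : Periodic2 (rho p) := by
  rintro x v ⟨a, b, rfl⟩
  unfold rho
  have h0 := sin_sq_add_int (x 0 - p 0) a
  have h1 := sin_sq_add_int (x 1 - p 1) b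
  rw [← h0, ← h1]
  simp
  congr 3 <;> ring_nf

theorem norm_sq_Pl (y : Pl) : ‖y‖ ^ 2 = y 0 ^ 2 + y 1 ^ 2 := by
  rw [EuclideanSpace.norm_sq_eq]; simp

/-- the nearest lattice vector. -/
def latRound (y : Pl) : Pl := ((round (y 0) : ℤ) : ℝ) • EuclideanSpace.single 0 (1:ℝ) +
      ((round (y 1) : ℤ) : ℝ) • EuclideanSpace.single 1 (1:ℝ)

theorem latRound_mem (y : Pl) : latRound y ∈ unitLattice := ⟨_, _, rfl⟩

theorem sin_round_lower (t : ℝ) : 4 * (t - round t) ^ 2 ≤ sin (π * t) ^ 2 := by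
  have h1 := sin_sq_add_int (t - round t) (round t)
  rw [sub_add_cancel] at h1
  rw [h1]
  have h2 : |π * (t - round t)| ≤ π / 2 := by
    rw [abs_mul, abs_of_pos pi_pos]
    nlinarith [abs_sub_round t, pi_pos]
  have h3 := mul_abs_le_abs_sin h2
  rw [abs_mul, abs_of_pos pi_pos, ← mul_assoc, div_mul_cancel₀ _ pi_ne_zero] at h3
  rw [← sq_abs (sin _), ← sq_abs (t - _)]
  nlinarith [abs_nonneg (t - round t)]

theorem sin_round_upper (t : ℝ) : sin (π * t) ^ 2 ≤ π ^ 2 * (t - round t) ^ 2 := by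
  have h1 := sin_sq_add_int (t - round t) (round t)
  rw [sub_add_cancel] at h1
  rw [h1, ← mul_pow]
  exact Real.sin_sq_le_sq

theorem rho_lower (p x : Pl) : 4 * ‖x - latRound (x - p) - p‖ ^ 2 ≤ rho p x := by
  have h0 := sin_round_lower (x 0 - p 0)
  have h1 := sin_round_lower (x 1 - p 1)
  rw [norm_sq_Pl]
  unfold rho
  simp [latRound]
  rw [sub_right_comm] at h0 h1
  linarith

theorem rho_upper (p x : Pl) : rho p x ≤ π ^ 2 * ‖x - latRound (x - p) - p‖ ^ 2 := by
  have h0 := sin_round_upper (x 0 - p 0)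
  have h1 := sin_round_upper (x 1 - p 1)
  rw [norm_sq_Pl]
  unfold rho
  simp [latRound]
  rw [sub_right_comm] at h0 h1
  linarith

theorem rho_eq_zero_iff (p x : Pl) : rho p x = 0 ↔ ∃ v ∈ unitLattice, x = p + v := by
  constructor
  · intro h
    refine ⟨latRound (x - p), latRound_mem _, ?_⟩
    have h1 := rho_lower p x
    have h2 : ‖x - latRound (x - p) - p‖ ^ 2 = 0 := by
      have := sq_nonneg ‖x - latRound (x - p) - p‖
      linarith
    have h3 := norm_eq_zero.1 (pow_eq_zero_iff (two_ne_zero) |>.1 h2)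
    rw [sub_sub, sub_eq_zero] at h3
    rw [add_comm]; exact h3
  · rintro ⟨v, hv, rfl⟩
    rw [rho_periodic p p v hv]
    simp [rho]

theorem hasDerivAt_pd_rho (p x : Pl) (i : Fin 2) :
    pd (rho p) i x = 2 * sin (π * (x i - p i)) * cos (π * (x i - p i)) * π := by
  have h : HasLineDerivAt ℝ (rho p) (2 * sin (π * (x i - p i)) * cos (π * (x i - p i)) * π) x
      (EuclideanSpace.single i (1:ℝ)) := by
    unfold HasLineDerivAt rho
    have hs : ∀ c d : ℝ, HasDerivAt (fun t : ℝ => sin (π * (c + t - d)) ^ 2)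
        (2 * sin (π * (c - d)) * cos (π * (c - d)) * π) 0 := by
      intro c d
      have h1 : HasDerivAt (fun t : ℝ => π * (c + t - d)) (π * 1) 0 :=
        (((hasDerivAt_id (0:ℝ)).const_add c).sub_const d).const_mul π
      refine (h1.sin.fun_pow 2).congr_deriv ?_
      simp
      ring
    fin_cases i
    · simpa using (hs (x 0) (p 0)).add_const (sin (π * (x 1 - p 1)) ^ 2)
    · simpa using (hs (x 1) (p 1)).const_add (sin (π * (x 0 - p 0)) ^ 2)
  exact h.lineDeriv

theorem abs_pd_rho_le (p x : Pl) (i : Fin 2) (η : ℝ) (hη : 0 < η) (h : rho p x ≤ 2 * η ^ 2) :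
    |pd (rho p) i x| ≤ 4 * π * η := by
  rw [hasDerivAt_pd_rho]
  have hs : sin (π * (x i - p i)) ^ 2 ≤ 2 * η ^ 2 := by
    refine le_trans ?_ h
    unfold rho
    fin_cases i
    · simpa using sq_nonneg _
    · simpa using sq_nonneg _
  have hs' : |sin (π * (x i - p i))| ≤ 2 * η := by
    refine abs_le_of_sq_le_sq ?_ (by positivity)
    nlinarith
  have hc := abs_cos_le_one (π * (x i - p i))
  rw [abs_mul, abs_mul, abs_mul, abs_two, abs_of_pos pi_pos]
  have : |sin (π * (x i - p i))| * |cos (π * (x i - p i))| ≤ 2 * η * 1 :=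
    mul_le_mul hs' hc (abs_nonneg _) (by positivity)
  nlinarith [pi_pos]

/-- The union of closed `η`-balls around the lattice translates of `p` close to `fund`. -/
def nearSet (p : Pl) (η : ℝ) : Set Pl :=
  ⋃ n ∈ (Finset.Icc (⌊-p 0⌋) (⌊-p 0⌋ + 2) ×ˢ Finset.Icc (⌊-p 1⌋) (⌊-p 1⌋ + 2) : Finset (ℤ × ℤ)),
    closedBall (p + ((n.1 : ℝ) • EuclideanSpace.single 0 (1:ℝ) +
      (n.2 : ℝ) • EuclideanSpace.single 1 (1:ℝ))) η

theorem measurableSet_nearSet (p : Pl) (η : ℝ) : MeasurableSet (nearSet p η) :=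
  Finset.measurableSet_biUnion _ fun _ _ => measurableSet_closedBall

theorem volume_nearSet (p : Pl) (η : ℝ) (hη : 0 < η) :
    volume (nearSet p η) ≤ ENNReal.ofReal (9 * π * η ^ 2) := by
  refine (measure_biUnion_finset_le _ _).trans ?_
  simp only [EuclideanSpace.volume_closedBall_fin_two, Finset.sum_const, Finset.card_product,
    Int.card_Icc]
  have e : ∀ k : ℤ, (k + 2 + 1 - k).toNat = 3 := fun k => by
    rw [show k + 2 + 1 - k = 3 by ring]; rfl
  rw [e, e, ← ENNReal.ofReal_pow hη.le, ← NNReal.coe_real_pi]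
  simp only [nsmul_eq_mul]
  rw [ENNReal.ofReal_mul (by positivity), ENNReal.ofReal_mul (by positivity)]
  simp
  ring_nf
  exact le_rfl

theorem round_range (t c : ℝ) (ht : t ∈ Ico (0:ℝ) 1) :
    round (t - c) ∈ Finset.Icc (⌊-c⌋) (⌊-c⌋ + 2) := by
  have h := abs_le.1 (abs_sub_round (t - c))
  have h1 := Int.floor_le (-c)
  have h2 := Int.lt_floor_add_one (-c)
  rw [Finset.mem_Icc]
  obtain ⟨h3, h4⟩ := ht
  constructor
  · have : ((⌊-c⌋ : ℤ) : ℝ) < ((round (t - c) + 1 : ℤ) : ℝ) := by push_cast; linarith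
    have := Int.cast_lt.1 this
    omega
  · have : ((round (t - c) : ℤ) : ℝ) < ((⌊-c⌋ + 3 : ℤ) : ℝ) := by push_cast; linarith
    have := Int.cast_lt.1 this
    omega

theorem norm_le_of_rho (p x : Pl) (η : ℝ) (hη : 0 < η) (h : rho p x ≤ 2 * η ^ 2) :
    ‖x - latRound (x - p) - p‖ < η := by
  have := rho_lower p x
  apply lt_of_pow_lt_pow_left₀ 2 hη.le
  nlinarith [pow_pos hη 2]

theorem mem_nearSet (p x : Pl) (hx : x ∈ fund) (η : ℝ) (hη : 0 < η) (h : rho p x ≤ 2 * η ^ 2) :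
    x ∈ nearSet p η := by
  unfold nearSet
  refine mem_iUnion₂.2 ⟨(round (x 0 - p 0), round (x 1 - p 1)),
    Finset.mem_product.2 ⟨round_range _ _ hx.1, round_range _ _ hx.2⟩, ?_⟩
  rw [mem_closedBall, dist_eq_norm]
  have := (norm_le_of_rho p x η hη h).le
  refine le_of_eq_of_le (congrArg _ ?_) this
  simp only [latRound, PiLp.sub_apply]
  abel

/-! ### Gradient estimates -/

theorem pd_periodic {u : Pl → ℝ} (hu : Periodic2 u) (i : Fin 2) : Periodic2 (pd u i) := by
  intro x v hv
  unfold pd lineDeriv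
  congr 1
  ext t
  rw [add_right_comm, hu _ v hv]

theorem logSing_pd_bound {u : Pl → ℝ} {p : Pl} {a : ℝ} (h : LogSing u p a) :
    ∃ r > 0, ∃ C : ℝ, 0 ≤ C ∧ ∀ x, x ≠ p → ‖x - p‖ < r → ∀ i,
      |pd u i x| ≤ 2 * |a| / ‖x - p‖ + C := by
  obtain ⟨r, hr, v, hv, huv⟩ := h
  have hcont : ContinuousOn (fun x => ‖fderiv ℝ v x‖) (closedBall p (r / 2)) := by
    have := hv.continuousOn_fderiv_of_isOpen isOpen_ball (by simp)
    exact (this.mono (closedBall_subset_ball (by linarith))).norm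
  obtain ⟨C, hC⟩ := (isCompact_closedBall p (r / 2)).bddAbove_image hcont
  have hC' : ∀ x ∈ closedBall p (r / 2), ‖fderiv ℝ v x‖ ≤ C :=
    fun x hx => hC (mem_image_of_mem _ hx)
  refine ⟨r / 2, by positivity, C,
    (norm_nonneg _).trans (hC' p (mem_closedBall_self (by positivity))), ?_⟩
  intro x hxp hxr i
  have hxb : x ∈ ball p r := by rw [mem_ball, dist_eq_norm]; linarith
  have hpos : 0 < ‖x - p‖ := norm_pos_iff.2 (sub_ne_zero.2 hxp)
  have heq : u =ᶠ[𝓝 x] fun y => a * Real.log (‖y - p‖ ^ 2) + v y := by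
    filter_upwards [isOpen_ball.mem_nhds hxb, isOpen_ne.mem_nhds hxp] with y hy hy'
    rw [huv y hy hy', Real.log_pow]
    push_cast
    ring
  have hvd : DifferentiableAt ℝ v x :=
    (hv.contDiffAt (isOpen_ball.mem_nhds hxb)).differentiableAt (by simp)
  have hn : HasFDerivAt (fun y : Pl => ‖y - p‖ ^ 2) (2 • (innerSL ℝ (x - p))) x := by
    have h1 : HasFDerivAt (fun y : Pl => y - p) (ContinuousLinearMap.id ℝ Pl) x :=
      (hasFDerivAt_id x).sub_const p
    exact h1.norm_sq
  have hfd := ((hn.log (by positivity)).const_mul a).add hvd.hasFDerivAt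
  have hpd : pd u i x = a * ((‖x - p‖ ^ 2)⁻¹ * (2 * inner ℝ (x - p)
      (EuclideanSpace.single i (1:ℝ)))) + fderiv ℝ v x (EuclideanSpace.single i (1:ℝ)) := by
    unfold pd
    rw [heq.lineDeriv_eq]
    refine (hfd.hasLineDerivAt _).lineDeriv.trans ?_
    simp
    exact Or.inl (Or.inl (inner_sub_left _ _ _).symm)
  rw [hpd]
  have hone : ‖(EuclideanSpace.single i (1:ℝ) : Pl)‖ = 1 := by simp
  have h1 : |inner ℝ (x - p) (EuclideanSpace.single i (1:ℝ))| ≤ ‖x - p‖ := by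
    have := abs_real_inner_le_norm (x - p) (EuclideanSpace.single i (1:ℝ))
    rwa [hone, mul_one] at this
  have h2 : |fderiv ℝ v x (EuclideanSpace.single i (1:ℝ))| ≤ C := by
    have := (fderiv ℝ v x).le_opNorm (EuclideanSpace.single i (1:ℝ))
    rw [hone, mul_one, Real.norm_eq_abs] at this
    exact this.trans (hC' x (by rw [mem_closedBall, dist_eq_norm]; exact hxr.le))
  refine (abs_add_le _ _).trans (add_le_add ?_ h2)
  rw [abs_mul, abs_mul, abs_mul, abs_two, abs_of_pos (by positivity : 0 < (‖x - p‖ ^ 2)⁻¹)]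
  calc |a| * ((‖x - p‖ ^ 2)⁻¹ * (2 * |inner ℝ (x - p) (EuclideanSpace.single i (1:ℝ))|))
      ≤ |a| * ((‖x - p‖ ^ 2)⁻¹ * (2 * ‖x - p‖)) := by gcongr
    _ = 2 * |a| / ‖x - p‖ := by field_simp

/-- The gradient bound, in terms of the periodic squared distance. -/
theorem pd_bound_rho {u : Pl → ℝ} {p : Pl} {a : ℝ} (hu : Periodic2 u) (h : LogSing u p a) :
    ∃ r > 0, ∃ C : ℝ, 0 ≤ C ∧ ∀ η, 0 < η → η < r → ∀ x, η ^ 2 ≤ rho p x → rho p x ≤ 2 * η ^ 2 →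
      ∀ i, |pd u i x| ≤ 2 * π * |a| / η + C := by
  obtain ⟨r, hr, C, hC, hb⟩ := logSing_pd_bound h
  refine ⟨r, hr, C, hC, ?_⟩
  intro η hη hηr x h1 h2 i
  set y := x - latRound (x - p) with hy
  have hlt : ‖y - p‖ < η := norm_le_of_rho p x η hη h2
  have hge : η ≤ π * ‖y - p‖ := by
    have := h1.trans (rho_upper p x)
    rw [← mul_pow] at this
    exact le_of_sq_le_sq this (by positivity)
  have hpos : 0 < ‖y - p‖ := by
    by_contra hcon
    have : ‖y - p‖ = 0 := le_antisymm (not_lt.1 hcon) (norm_nonneg _)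
    rw [this] at hge
    linarith
  have hyp : y ≠ p := sub_ne_zero.1 (norm_pos_iff.1 hpos)
  have hpx : pd u i x = pd u i y := by
    have := pd_periodic hu i y (latRound (x - p)) (latRound_mem _)
    rwa [hy, sub_add_cancel] at this
  rw [hpx]
  refine (hb y hyp (hlt.trans hηr) i).trans ?_
  gcongr ?_ + _
  rw [div_le_div_iff₀ hpos hη]
  nlinarith [mul_le_mul_of_nonneg_left hge (abs_nonneg a)]

/-! ### Cutoff functions -/

theorem deriv_smoothTransition_bound : ∃ K > 0, ∀ t, |deriv Real.smoothTransition t| ≤ K := by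
  have hc : Continuous (deriv Real.smoothTransition) :=
    (Real.smoothTransition.contDiff (n := 1)).continuous_deriv (by norm_num)
  obtain ⟨K, hK⟩ := (isCompact_Icc (a := (0:ℝ)) (b := 1)).bddAbove_image hc.abs.continuousOn
  refine ⟨max K 1, by positivity, fun t => ?_⟩
  by_cases ht : t ∈ Icc (0:ℝ) 1
  · exact (hK (mem_image_of_mem _ ht)).trans (le_max_left _ _)
  · have h0 : deriv Real.smoothTransition t = 0 := by
      rw [mem_Icc, not_and_or, not_le, not_le] at ht
      rcases ht with ht | ht
      · have : Real.smoothTransition =ᶠ[𝓝 t] fun _ => 0 := by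
          filter_upwards [isOpen_Iio.mem_nhds ht] with y hy
          exact Real.smoothTransition.zero_of_nonpos (le_of_lt hy)
        rw [this.deriv_eq]; simp
      · have : Real.smoothTransition =ᶠ[𝓝 t] fun _ => 1 := by
          filter_upwards [isOpen_Ioi.mem_nhds ht] with y hy
          exact Real.smoothTransition.one_of_one_le (le_of_lt hy)
        rw [this.deriv_eq]; simp
    rw [h0, abs_zero]; positivity

theorem deriv_smoothTransition_supp (t : ℝ) (h : deriv Real.smoothTransition t ≠ 0) :
    t ∈ Icc (0:ℝ) 1 := by
  by_contra ht
  apply h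
  rw [mem_Icc, not_and_or, not_le, not_le] at ht
  rcases ht with ht | ht
  · have : Real.smoothTransition =ᶠ[𝓝 t] fun _ => 0 := by
      filter_upwards [isOpen_Iio.mem_nhds ht] with y hy
      exact Real.smoothTransition.zero_of_nonpos (le_of_lt hy)
    rw [this.deriv_eq]; simp
  · have : Real.smoothTransition =ᶠ[𝓝 t] fun _ => 1 := by
      filter_upwards [isOpen_Ioi.mem_nhds ht] with y hy
      exact Real.smoothTransition.one_of_one_le (le_of_lt hy)
    rw [this.deriv_eq]; simp

/-- Smooth periodic cutoff vanishing near the lattice translates of `p`. -/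
def cut (η : ℝ) (p x : Pl) : ℝ := Real.smoothTransition (rho p x / η ^ 2 - 1)

theorem cut_contDiff (η : ℝ) (p : Pl) : ContDiff ℝ 1 (cut η p) :=
  (Real.smoothTransition.contDiff (n := 1)).comp
    (((rho_contDiff p).div_const _).sub contDiff_const)

theorem cut_periodic (η : ℝ) (p : Pl) : Periodic2 (cut η p) := by
  intro x v hv
  unfold cut
  rw [rho_periodic p x v hv]

theorem hasDerivAt_line {u : Pl → ℝ} {x : Pl} (h : DifferentiableAt ℝ u x) (i : Fin 2) :
    HasDerivAt (fun t : ℝ => u (x + t • EuclideanSpace.single i (1:ℝ))) (pd u i x) 0 := by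
  have := h.lineDifferentiableAt (v := EuclideanSpace.single i (1:ℝ)) |>.hasLineDerivAt
  exact this

theorem pd_cut (η : ℝ) (p x : Pl) (i : Fin 2) :
    pd (cut η p) i x = deriv Real.smoothTransition (rho p x / η ^ 2 - 1) *
      (pd (rho p) i x / η ^ 2) := by
  have h1 := hasDerivAt_line ((rho_contDiff p).differentiable (by norm_num) x) i
  have h2 := (h1.div_const (η ^ 2)).sub_const 1
  have h3 : HasDerivAt Real.smoothTransition (deriv Real.smoothTransition (rho p x / η ^ 2 - 1))
      (rho p (x + (0:ℝ) • EuclideanSpace.single i (1:ℝ)) / η ^ 2 - 1) := by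
    rw [zero_smul, add_zero]
    exact ((Real.smoothTransition.contDiff (n := 1)).differentiable (by norm_num) _).hasDerivAt
  exact (h3.comp (0:ℝ) h2).deriv

theorem pd_cut_supp (η : ℝ) (hη : 0 < η) (p x : Pl) (i : Fin 2) (h : pd (cut η p) i x ≠ 0) :
    η ^ 2 ≤ rho p x ∧ rho p x ≤ 2 * η ^ 2 := by
  rw [pd_cut] at h
  have := deriv_smoothTransition_supp _ (left_ne_zero_of_mul h)
  obtain ⟨h1, h2⟩ := this
  have hp := pow_pos hη 2
  constructor
  · have : 1 ≤ rho p x / η ^ 2 := by linarith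
    rwa [le_div_iff₀ hp, one_mul] at this
  · have : rho p x / η ^ 2 ≤ 2 := by linarith
    rwa [div_le_iff₀ hp] at this

theorem abs_pd_cut_le (K : ℝ) (hK : ∀ t, |deriv Real.smoothTransition t| ≤ K)
    (η : ℝ) (hη : 0 < η) (p x : Pl) (i : Fin 2) : |pd (cut η p) i x| ≤ 4 * π * K / η := by
  have hK0 : 0 ≤ K := (abs_nonneg _).trans (hK 0)
  by_cases h : pd (cut η p) i x = 0
  · rw [h, abs_zero]; positivity
  · have h2 := (pd_cut_supp η hη p x i h).2
    rw [pd_cut, abs_mul, abs_div, abs_of_pos (pow_pos hη 2)]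
    calc _ ≤ K * (4 * π * η / η ^ 2) := by
          gcongr
          · exact hK _
          · exact abs_pd_rho_le p x i η hη h2
      _ = 4 * π * K / η := by field_simp

/-- Product of all the cutoffs. -/
def psi {ι : Type} [Fintype ι] (P : ι → Pl) (η : ℝ) (x : Pl) : ℝ := ∏ j, cut η (P j) x

section psi
variable {ι : Type} [Fintype ι] (P : ι → Pl) (η : ℝ)

theorem psi_contDiff : ContDiff ℝ 1 (psi P η) :=
  contDiff_prod fun j _ => cut_contDiff η (P j)

theorem psi_periodic : Periodic2 (psi P η) := by
  intro x v hv
  unfold psi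
  exact Finset.prod_congr rfl fun j _ => cut_periodic η (P j) x v hv

theorem cut_nonneg (p x : Pl) : 0 ≤ cut η p x := Real.smoothTransition.nonneg _
theorem cut_le_one (p x : Pl) : cut η p x ≤ 1 := Real.smoothTransition.le_one _

theorem psi_nonneg (x : Pl) : 0 ≤ psi P η x := Finset.prod_nonneg fun j _ => cut_nonneg η (P j) x
theorem psi_le_one (x : Pl) : psi P η x ≤ 1 :=
  Finset.prod_le_one (fun j _ => cut_nonneg η (P j) x) (fun j _ => cut_le_one η (P j) x)

theorem psi_eventually_zero (hη : 0 < η) (x : Pl) (j : ι) (hx : rho (P j) x = 0) :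
    ∀ᶠ y in 𝓝 x, psi P η y = 0 := by
  have hc : Continuous (rho (P j)) := (rho_contDiff (P j)).continuous
  have : ∀ᶠ y in 𝓝 x, rho (P j) y < η ^ 2 :=
    hc.continuousAt.eventually_lt continuousAt_const (by rw [hx]; positivity)
  filter_upwards [this] with y hy
  refine Finset.prod_eq_zero (Finset.mem_univ j) ?_
  apply Real.smoothTransition.zero_of_nonpos
  have : rho (P j) y / η ^ 2 < 1 := by rw [div_lt_one (by positivity)]; exact hy
  linarith

theorem abs_pd_psi_le (x : Pl) (i : Fin 2) :
    |pd (psi P η) i x| ≤ ∑ j, |pd (cut η (P j)) i x| := by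
  classical
  have h : HasDerivAt (fun t : ℝ => psi P η (x + t • EuclideanSpace.single i (1:ℝ)))
      (∑ j, (∏ k ∈ Finset.univ.erase j, cut η (P k) (x + (0:ℝ) • EuclideanSpace.single i (1:ℝ))) •
        pd (cut η (P j)) i x) 0 :=
    HasDerivAt.fun_finsetProd fun j _ =>
      hasDerivAt_line ((cut_contDiff η (P j)).differentiable (by norm_num) x) i
  have e : pd (psi P η) i x = _ := h.deriv
  rw [e]
  refine (Finset.abs_sum_le_sum_abs _ _).trans (Finset.sum_le_sum fun j _ => ?_)
  rw [smul_eq_mul, abs_mul]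
  have h1 : |∏ k ∈ Finset.univ.erase j, cut η (P k) (x + (0:ℝ) • EuclideanSpace.single i (1:ℝ))|
      ≤ 1 := by
    rw [abs_of_nonneg (Finset.prod_nonneg fun k _ => cut_nonneg η (P k) _)]
    exact Finset.prod_le_one (fun k _ => cut_nonneg η (P k) _) (fun k _ => cut_le_one η (P k) _)
  calc _ ≤ 1 * |pd (cut η (P j)) i x| := by gcongr
    _ = _ := one_mul _

end psi

/-! ### The main inequality -/

theorem pd_contDiffAt {u : Pl → ℝ} {x : Pl} (h : ContDiffAt ℝ 2 u x) (i : Fin 2) :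
    ContDiffAt ℝ 1 (pd u i) x := by
  have h1 : ContDiffAt ℝ 1 (fun y => fderiv ℝ u y (EuclideanSpace.single i (1:ℝ))) x :=
    (h.fderiv_right (m := 1) (by norm_num)).clm_apply contDiffAt_const
  refine h1.congr_of_eventuallyEq ?_
  have h2 : ∀ᶠ y in 𝓝 x, ContDiffAt ℝ 2 u y := h.eventually (by simp)
  filter_upwards [h2] with y hy
  exact pd_eq_fderiv (hy.differentiableAt (by norm_num)) i

/-- The vector field to which we apply the divergence theorem. -/
def vf {ι : Type} [Fintype ι] (P : ι → Pl) (η k : ℝ) (u : Pl → ℝ) (i : Fin 2) (x : Pl) : ℝ :=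
  psi P η x * (-arctan (k * u x) * pd u i x)

section main
variable {ι : Type} [Fintype ι] (P : ι → Pl) (u : Pl → ℝ)

theorem vf_eventually_zero (η k : ℝ) (hη : 0 < η) (i : Fin 2) (x : Pl) (j : ι)
    (hx : rho (P j) x = 0) : vf P η k u i =ᶠ[𝓝 x] fun _ => 0 := by
  filter_upwards [psi_eventually_zero P η hη x j hx] with y hy
  rw [vf, hy, zero_mul]

theorem vf_contDiff (hsm : ∀ x, (∀ j, rho (P j) x ≠ 0) → ContDiffAt ℝ 2 u x)
    (η k : ℝ) (hη : 0 < η) (i : Fin 2) : ContDiff ℝ 1 (vf P η k u i) := by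
  rw [contDiff_iff_contDiffAt]
  intro x
  by_cases hx : ∀ j, rho (P j) x ≠ 0
  · have h := hsm x hx
    have h1 : ContDiffAt ℝ 1 (fun y => arctan (k * u y)) x :=
      (Real.contDiff_arctan.contDiffAt).comp x
        (contDiffAt_const.mul (h.of_le (by norm_num)))
    exact (psi_contDiff P η).contDiffAt.mul (h1.neg.mul (pd_contDiffAt h i))
  · push Not at hx
    obtain ⟨j, hj⟩ := hx
    exact contDiffAt_const.congr_of_eventuallyEq (vf_eventually_zero P u η k hη i x j hj)

theorem vf_periodic (hu : Periodic2 u) (η k : ℝ) (i : Fin 2) : Periodic2 (vf P η k u i) := by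
  intro x v hv
  unfold vf
  rw [psi_periodic P η x v hv, hu x v hv, pd_periodic hu i x v hv]

theorem pd_vf (η k : ℝ) (i : Fin 2) (x : Pl) (h : ContDiffAt ℝ 2 u x) :
    pd (vf P η k u i) i x = pd (psi P η) i x * (-arctan (k * u x) * pd u i x) +
      psi P η x * (-(1 / (1 + (k * u x) ^ 2) * (k * pd u i x)) * pd u i x +
        -arctan (k * u x) * pd (pd u i) i x) := by
  have h1 := hasDerivAt_line ((psi_contDiff P η).differentiable (by norm_num) x) i
  have h2 := hasDerivAt_line (h.differentiableAt (by norm_num)) i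
  have h3 := hasDerivAt_line ((pd_contDiffAt h i).differentiableAt (by norm_num)) i
  have h4 := h1.fun_mul (((h2.const_mul k).arctan.fun_neg).fun_mul h3)
  have e : pd (vf P η k u i) i x = _ := h4.deriv
  rw [e]
  simp

theorem main_ineq (a : ι → ℝ) (hu : Periodic2 u)
    (hsm : ∀ x, (∀ j, rho (P j) x ≠ 0) → ContDiffAt ℝ 2 u x)
    (hsing : ∀ j, LogSing u (P j) (a j)) (f : ℝ → ℝ) (c : ℝ) (hc : 0 ≤ c)
    (hpde : ∀ x, (∀ j, rho (P j) x ≠ 0) → lap u x = -(c * f (u x)))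
    (hf : ∀ k t : ℝ, 0 < k → 0 ≤ -arctan (k * t) * f t)
    (K : ℝ) (hK : ∀ t, |deriv Real.smoothTransition t| ≤ K) :
    ∃ r > 0, ∃ C : ℝ, ∀ η k, 0 < η → η < r → 0 < k →
      ∫ x in fund, psi P η x * (c * (-arctan (k * u x) * f (u x))) ≤
        72 * π ^ 4 * K * ∑ j, |a j| + C * η := by
  have hK0 : 0 ≤ K := (abs_nonneg _).trans (hK 0)
  choose r hr C hC hb using fun j => pd_bound_rho hu (hsing j)
  obtain ⟨R, hR, hRr⟩ : ∃ R > 0, ∀ j, R ≤ r j := by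
    rcases isEmpty_or_nonempty ι with hι | hι
    · exact ⟨1, one_pos, fun j => isEmptyElim j⟩
    · obtain ⟨j0, hj0⟩ := Finite.exists_min r
      exact ⟨r j0, hr j0, hj0⟩
  refine ⟨R, hR, 36 * π ^ 3 * K * ∑ j, C j, ?_⟩
  intro η k hη hηR hk
  let D : ι → ℝ := fun j => (4 * π * K / η) * (2 * π * |a j| / η + C j)
  have hD : ∀ j, 0 ≤ D j := fun j => by
    have := hC j
    positivity
  let I : ι → Pl → ℝ := fun j => (nearSet (P j) η).indicator fun _ => π * D j
  have hI0 : ∀ j x, 0 ≤ I j x := fun j x =>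
    indicator_nonneg (fun _ _ => mul_nonneg pi_pos.le (hD j)) x
  have hterm : ∀ j, ∀ x ∈ fund, ∀ i, π * (|pd (cut η (P j)) i x| * |pd u i x|) ≤ I j x := by
    intro j x hx i
    by_cases h0 : pd (cut η (P j)) i x = 0
    · rw [h0, abs_zero, zero_mul, mul_zero]; exact hI0 j x
    · obtain ⟨h1, h2⟩ := pd_cut_supp η hη (P j) x i h0
      have hmem := mem_nearSet (P j) x hx η hη h2
      simp only [I, indicator_of_mem hmem]
      gcongr
      exact mul_le_mul (abs_pd_cut_le K hK η hη (P j) x i)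
        (hb j η hη (hηR.trans_le (hRr j)) x h1 h2 i) (abs_nonneg _) (by positivity)
  have hgrad : ∀ x ∈ fund, ∀ i, π * |pd (psi P η) i x * pd u i x| ≤ ∑ j, I j x := by
    intro x hx i
    rw [abs_mul]
    calc π * (|pd (psi P η) i x| * |pd u i x|)
        ≤ π * ((∑ j, |pd (cut η (P j)) i x|) * |pd u i x|) := by
          gcongr
          exact abs_pd_psi_le P η x i
      _ = ∑ j, π * (|pd (cut η (P j)) i x| * |pd u i x|) := by
          rw [Finset.sum_mul, Finset.mul_sum]
      _ ≤ _ := Finset.sum_le_sum fun j _ => hterm j x hx i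
  have hnn : ∀ x, 0 ≤ psi P η x * (c * (-arctan (k * u x) * f (u x))) := fun x =>
    mul_nonneg (psi_nonneg P η x) (mul_nonneg hc (hf k (u x) hk))
  have hpoint : ∀ x ∈ fund, psi P η x * (c * (-arctan (k * u x) * f (u x))) ≤
      -(pd (vf P η k u 0) 0 x + pd (vf P η k u 1) 1 x) + ∑ j, I j x := by
    intro x hx
    by_cases hxz : ∀ j, rho (P j) x ≠ 0
    · have h2 := hsm x hxz
      rw [pd_vf P u η k 0 x h2, pd_vf P u η k 1 x h2]
      have hl := hpde x hxz
      unfold lap at hl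
      have hg : |-arctan (k * u x)| ≤ π / 2 := by
        rw [abs_neg, abs_le]
        exact ⟨(neg_pi_div_two_lt_arctan _).le, (arctan_lt_pi_div_two _).le⟩
      set g := -arctan (k * u x) with hgdef
      have hest : ∀ i, pd (psi P η) i x * (g * pd u i x) ≤ (∑ j, I j x) / 2 := by
        intro i
        calc pd (psi P η) i x * (g * pd u i x) = g * (pd (psi P η) i x * pd u i x) := by ring
          _ ≤ |g| * |pd (psi P η) i x * pd u i x| := by rw [← abs_mul]; exact le_abs_self _
          _ ≤ π / 2 * |pd (psi P η) i x * pd u i x| := by gcongr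
          _ ≤ _ := by linarith [hgrad x hx i]
      have hneg : ∀ i, 0 ≤ psi P η x * (1 / (1 + (k * u x) ^ 2) * (k * pd u i x) * pd u i x) := by
        intro i
        refine mul_nonneg (psi_nonneg P η x) ?_
        rw [mul_assoc, mul_assoc]
        have := mul_self_nonneg (pd u i x)
        positivity
      have hl2 : psi P η x * (c * (g * f (u x))) =
          - (psi P η x * g * (pd (pd u 0) 0 x + pd (pd u 1) 1 x)) := by
        rw [hl]; ring
      rw [hl2]
      linarith [hest 0, hest 1, hneg 0, hneg 1]
    · push Not at hxz
      obtain ⟨j, hj⟩ := hxz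
      have e : ∀ i, pd (vf P η k u i) i x = 0 := by
        intro i
        unfold pd
        rw [(vf_eventually_zero P u η k hη i x j hj).lineDeriv_eq]
        simp [lineDeriv]
      rw [e, e, (psi_eventually_zero P η hη x j hj).self_of_nhds, zero_mul]
      have := Finset.sum_nonneg fun j (_ : j ∈ Finset.univ) => hI0 j x
      linarith
  have hX := fun i => vf_contDiff P u hsm η k hη i
  have hInt1 : IntegrableOn (fun x => pd (vf P η k u 0) 0 x + pd (vf P η k u 1) 1 x) fund :=
    continuous_integrableOn_fund ((continuous_pd (hX 0) 0).add (continuous_pd (hX 1) 1))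
  have hInt1' : IntegrableOn (fun x => -(pd (vf P η k u 0) 0 x + pd (vf P η k u 1) 1 x)) fund :=
    hInt1.neg
  have hfin : IsFiniteMeasure (volume.restrict fund) := ⟨by simpa using fund_volume_lt_top⟩
  have hInt2 : ∀ j, IntegrableOn (I j) fund := fun j =>
    (integrable_const _).indicator (measurableSet_nearSet _ _)
  have hInt3 : IntegrableOn (fun x => ∑ j, I j x) fund := integrable_finsetSum _ fun j _ => hInt2 j
  have hIj : ∀ j, ∫ x in fund, I j x ≤ 9 * π * η ^ 2 * (π * D j) := by
    intro j
    simp only [I]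
    rw [integral_indicator_const _ (measurableSet_nearSet _ _), smul_eq_mul]
    have hDj := hD j
    gcongr
    rw [Measure.real]
    refine ENNReal.toReal_le_of_le_ofReal (by positivity) ?_
    exact (Measure.restrict_apply_le _ _).trans (volume_nearSet (P j) η hη)
  calc ∫ x in fund, psi P η x * (c * (-arctan (k * u x) * f (u x)))
      ≤ ∫ x in fund, (-(pd (vf P η k u 0) 0 x + pd (vf P η k u 1) 1 x) + ∑ j, I j x) := by
        refine integral_mono_of_nonneg (Eventually.of_forall hnn) (hInt1'.add hInt3) ?_
        exact (ae_restrict_iff' measurableSet_fund).2 (Eventually.of_forall hpoint)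
    _ = ∑ j, ∫ x in fund, I j x := by
        rw [integral_add hInt1' hInt3, integral_neg,
          integral_div_eq_zero (vf P η k u) hX (vf_periodic P u hu η k), neg_zero, zero_add,
          integral_finsetSum _ fun j _ => hInt2 j]
    _ ≤ ∑ j, 9 * π * η ^ 2 * (π * D j) := Finset.sum_le_sum fun j _ => hIj j
    _ = ∑ j, (72 * π ^ 4 * K * |a j| + 36 * π ^ 3 * K * C j * η) := by
        refine Finset.sum_congr rfl fun j _ => ?_
        simp only [D]
        field_simp
        ring
    _ = _ := by
        rw [Finset.sum_add_distrib, ← Finset.mul_sum, ← Finset.sum_mul, ← Finset.mul_sum]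

end main

/-! ### The nonlinearity -/

theorem fτ_nonneg (τ : ℝ) (hτ : 0 < τ) (t : ℝ) (ht : t ≤ 0) : 0 ≤ fτ τ t := by
  unfold fτ
  have h1 : exp t ≤ 1 := exp_le_one_iff.2 ht
  have h2 := exp_pos t
  exact div_nonneg (mul_nonneg h2.le (by linarith)) (by positivity)

theorem fτ_nonpos (τ : ℝ) (hτ : 0 < τ) (t : ℝ) (ht : 0 ≤ t) : fτ τ t ≤ 0 := by
  unfold fτ
  have h1 : 1 ≤ exp t := one_le_exp ht
  have h2 := exp_pos t
  exact div_nonpos_of_nonpos_of_nonneg (mul_nonpos_of_nonneg_of_nonpos h2.le (by linarith))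
    (by positivity)

theorem neg_arctan_mul_fτ (τ : ℝ) (hτ : 0 < τ) (k t : ℝ) (hk : 0 < k) :
    -arctan (k * t) * fτ τ t = |arctan (k * t)| * |fτ τ t| := by
  rcases le_total t 0 with ht | ht
  · have : arctan (k * t) ≤ 0 := by
      rw [← arctan_zero]
      exact arctan_strictMono.monotone (mul_nonpos_of_nonneg_of_nonpos hk.le ht)
    rw [abs_of_nonpos this, abs_of_nonneg (fτ_nonneg τ hτ t ht)]
  · have : 0 ≤ arctan (k * t) := by
      rw [← arctan_zero]
      exact arctan_strictMono.monotone (mul_nonneg hk.le ht)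
    rw [abs_of_nonneg this, abs_of_nonpos (fτ_nonpos τ hτ t ht)]
    ring

theorem abs_fτ_le (τ : ℝ) (hτ : 0 < τ) (t : ℝ) : |fτ τ t| ≤ 1 / τ ^ 2 + 1 / τ := by
  unfold fτ
  have h2 := exp_pos t
  set s := exp t
  rw [abs_div, abs_of_pos (by positivity : 0 < (τ + s) ^ 3), abs_mul, abs_of_pos h2]
  have h3 : |1 - s| ≤ 1 + s := by rw [abs_le]; constructor <;> linarith
  have e : 1 / τ ^ 2 + 1 / τ = (1 + τ) / τ ^ 2 := by field_simp
  rw [e, div_le_div_iff₀ (by positivity) (by positivity)]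
  calc s * |1 - s| * τ ^ 2 ≤ s * (1 + s) * τ ^ 2 := by gcongr
    _ ≤ (1 + τ) * (τ + s) ^ 3 := by
      have : (1 + τ) * (τ + s) ^ 3 - s * (1 + s) * τ ^ 2 =
        τ ^ 3 + 2 * τ ^ 2 * s + 3 * τ * s ^ 2 + s ^ 3 +
          τ ^ 4 + 3 * τ ^ 3 * s + 2 * τ ^ 2 * s ^ 2 + τ * s ^ 3 := by ring
      have h : 0 ≤ τ ^ 3 + 2 * τ ^ 2 * s + 3 * τ * s ^ 2 + s ^ 3 +
          τ ^ 4 + 3 * τ ^ 3 * s + 2 * τ ^ 2 * s ^ 2 + τ * s ^ 3 := by positivity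
      linarith

/-- **Lemma 3.1.** There is a constant `M₀ ∈ (0,∞)`, depending only on
`τ`, `N₁`, `N₂`, such that every solution of `(E_ε)` (any `ε > 0`) satisfies
`∫_Ω ε⁻² |e^u(1−e^u)/(τ+e^u)³| dx ≤ M₀`. -/
theorem uniform_L1_bound
    (τ : ℝ) (hτ : 0 < τ) (N1 N2 : ℝ) :
    ∃ M₀ > 0, ∀ V : VortexData, V.N1 = N1 → V.N2 = N2 →
      ∀ ε : ℝ, 0 < ε → ∀ u : Pl → ℝ, IsSolution V τ ε u →
        (∫ x in fund, (ε ^ 2)⁻¹ * |fτ τ (u x)|) ≤ M₀ := by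
  obtain ⟨K, hK0, hK⟩ := deriv_smoothTransition_bound
  refine ⟨144 * π ^ 3 * K * (|N1| + |N2|) + 1, by positivity, ?_⟩
  rintro V rfl rfl ε hε u hu
  let P : Fin V.d₁ ⊕ Fin V.d₂ → Pl := Sum.elim V.p₁ V.p₂
  let a : Fin V.d₁ ⊕ Fin V.d₂ → ℝ := Sum.elim V.m₁ (fun j => -(V.m₂ j))
  have hsum : ∑ j, |a j| = |V.N1| + |V.N2| := by
    rw [Fintype.sum_sum_type]
    simp only [a, Sum.elim_inl, Sum.elim_inr, abs_neg, VortexData.N1, VortexData.N2]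
    rw [abs_of_nonneg (Finset.sum_nonneg fun j _ => V.m₁_nonneg j),
      abs_of_nonneg (Finset.sum_nonneg fun j _ => V.m₂_nonneg j)]
    congr 1
    · exact Finset.sum_congr rfl fun j _ => abs_of_nonneg (V.m₁_nonneg j)
    · exact Finset.sum_congr rfl fun j _ => abs_of_nonneg (V.m₂_nonneg j)
  have hZ : ∀ x, x ∈ V.Z ↔ ∃ j, rho (P j) x = 0 := by
    intro x
    simp only [rho_eq_zero_iff, Sum.exists, P, Sum.elim_inl, Sum.elim_inr, VortexData.Z,
      VortexData.Z1, VortexData.Z2, mem_union, mem_ofPred_eq]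
  have hZ' : ∀ x, (∀ j, rho (P j) x ≠ 0) ↔ x ∉ V.Z := by
    intro x
    rw [hZ]; push Not; rfl
  have hZclosed : IsClosed V.Z := by
    have : V.Z = ⋃ j, {x | rho (P j) x = 0} := by
      ext x; rw [hZ]; simp
    rw [this]
    exact isClosed_iUnion_of_finite fun j =>
      isClosed_eq (rho_contDiff (P j)).continuous continuous_const
  have hlat : unitLattice.Countable := by
    have : unitLattice = Set.range (fun n : ℤ × ℤ => ((n.1 : ℝ) • EuclideanSpace.single 0 (1:ℝ) +
      (n.2 : ℝ) • EuclideanSpace.single 1 (1:ℝ) : Pl)) := by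
      ext v
      simp only [unitLattice, mem_ofPred_eq, mem_range, Prod.exists]
      constructor <;> rintro ⟨a, b, h⟩ <;> exact ⟨a, b, h.symm⟩
    rw [this]
    exact countable_range _
  have hZcount : V.Z.Countable := by
    have : V.Z ⊆ ⋃ j, (fun v => P j + v) '' unitLattice := by
      intro x hx
      obtain ⟨j, hj⟩ := (hZ x).1 hx
      obtain ⟨v, hv, rfl⟩ := (rho_eq_zero_iff _ _).1 hj
      exact mem_iUnion.2 ⟨j, v, hv, rfl⟩
    exact (countable_iUnion fun j => hlat.image _).mono this
  have hae : ∀ᵐ x : Pl, x ∉ V.Z := hZcount.ae_notMem volume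
  set c := (ε ^ 2)⁻¹ with hcdef
  have hc : 0 ≤ c := by positivity
  obtain ⟨r, hr, C, hmain⟩ := main_ineq P u a hu.periodic
    (fun x hx => (hu.smooth.contDiffAt
      (hZclosed.isOpen_compl.mem_nhds ((hZ' x).1 hx))).of_le (by
        have : ((2 : ℕ∞) : WithTop ℕ∞) ≤ ((⊤ : ℕ∞) : WithTop ℕ∞) := WithTop.coe_le_coe.2 le_top
        exact this))
    (fun j => by
      rcases j with j | j
      · exact hu.sing₁ j
      · exact hu.sing₂ j)
    (fτ τ) c hc (fun x hx => by linarith [hu.pde x ((hZ' x).1 hx)])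
    (fun k t hk => by rw [neg_arctan_mul_fτ τ hτ k t hk]; positivity) K hK
  have hmeasu : AEMeasurable u volume := by
    have h1 : AEMeasurable u (volume.restrict V.Zᶜ) :=
      hu.smooth.continuousOn.aemeasurable hZclosed.measurableSet.compl
    rwa [Measure.restrict_eq_self_of_ae_mem (s := V.Zᶜ) hae] at h1
  have hmf : Measurable (fτ τ) := by
    unfold fτ
    fun_prop
  have hfin : IsFiniteMeasure (volume.restrict fund) := ⟨by simpa using fund_volume_lt_top⟩
  let η : ℕ → ℝ := fun n => 1 / ((n : ℝ) + 1)
  let k : ℕ → ℝ := fun n => (n : ℝ) + 1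
  have hηpos : ∀ n, 0 < η n := fun n => by positivity
  have hkpos : ∀ n, 0 < k n := fun n => by positivity
  have hη0 : Tendsto η atTop (𝓝 0) := tendsto_one_div_add_atTop_nhds_zero_nat
  have hk0 : Tendsto k atTop atTop :=
    tendsto_atTop_add_const_right _ _ tendsto_natCast_atTop_atTop
  have hlim : Tendsto (fun n => ∫ x in fund, psi P (η n) x *
      (c * (-arctan (k n * u x) * fτ τ (u x)))) atTop
      (𝓝 (∫ x in fund, π / 2 * (c * |fτ τ (u x)|))) := by
    refine tendsto_integral_of_dominated_convergence (fun _ => c * (π / 2 * (1 / τ ^ 2 + 1 / τ)))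
      (fun n => ?_) (integrable_const _) (fun n => ?_) ?_
    · have h1 : AEMeasurable (psi P (η n)) (volume.restrict fund) :=
        (psi_contDiff P (η n)).continuous.measurable.aemeasurable
      have h2 : AEMeasurable u (volume.restrict fund) := hmeasu.restrict
      have h3 : AEMeasurable (fun x => arctan (k n * u x)) (volume.restrict fund) :=
        (Real.measurable_arctan).comp_aemeasurable (h2.const_mul _)
      exact (h1.mul ((h3.neg.mul (hmf.comp_aemeasurable h2)).const_mul c)).aestronglyMeasurable
    · refine Eventually.of_forall fun x => ?_
      rw [neg_arctan_mul_fτ τ hτ _ _ (hkpos n), Real.norm_eq_abs, abs_mul, abs_mul, abs_mul,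
        abs_abs, abs_abs, abs_of_nonneg hc, abs_of_nonneg (psi_nonneg P (η n) x)]
      have h1 := psi_le_one P (η n) x
      have h2 : |arctan (k n * u x)| ≤ π / 2 :=
        abs_le.2 ⟨(neg_pi_div_two_lt_arctan _).le, (arctan_lt_pi_div_two _).le⟩
      have h3 := abs_fτ_le τ hτ (u x)
      calc psi P (η n) x * (c * (|arctan (k n * u x)| * |fτ τ (u x)|))
          ≤ 1 * (c * (π / 2 * (1 / τ ^ 2 + 1 / τ))) := by gcongr
        _ = _ := one_mul _
    · filter_upwards [ae_restrict_of_ae hae] with x hx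
      have h1 : ∀ᶠ n in atTop, psi P (η n) x = 1 := by
        have : ∀ j, ∀ᶠ n in atTop, cut (η n) (P j) x = 1 := by
          intro j
          have hpos : 0 < rho (P j) x :=
            lt_of_le_of_ne (rho_nonneg _ _) (Ne.symm ((hZ' x).2 hx j))
          have ht : Tendsto (fun n => 2 * η n ^ 2) atTop (𝓝 0) := by
            simpa using (hη0.pow 2).const_mul 2
          filter_upwards [ht.eventually (gt_mem_nhds hpos)] with n hn
          apply Real.smoothTransition.one_of_one_le
          have : 2 ≤ rho (P j) x / η n ^ 2 := by
            rw [le_div_iff₀ (pow_pos (hηpos n) 2)]; exact hn.le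
          linarith
        filter_upwards [eventually_all.2 this] with n hn
        exact Finset.prod_eq_one fun j _ => hn j
      have h2 : Tendsto (fun n => c * (-arctan (k n * u x) * fτ τ (u x))) atTop
          (𝓝 (π / 2 * (c * |fτ τ (u x)|))) := by
        have h3 : Tendsto (fun n => -arctan (k n * u x) * fτ τ (u x)) atTop
            (𝓝 (π / 2 * |fτ τ (u x)|)) := by
          rcases lt_trichotomy (u x) 0 with h | h | h
          · have e : Tendsto (fun n => -arctan (k n * u x)) atTop (𝓝 (-(-(π / 2)))) :=
              ((tendsto_arctan_atBot.mono_right nhdsWithin_le_nhds).comp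
                (hk0.atTop_mul_const_of_neg h)).neg
            rw [abs_of_nonneg (fτ_nonneg τ hτ _ h.le)]
            simpa using e.mul_const (fτ τ (u x))
          · simp [h, fτ]
          · have e : Tendsto (fun n => -arctan (k n * u x)) atTop (𝓝 (-(π / 2))) :=
              ((tendsto_arctan_atTop.mono_right nhdsWithin_le_nhds).comp
                (hk0.atTop_mul_const h)).neg
            rw [abs_of_nonpos (fτ_nonpos τ hτ _ h.le)]
            simpa using e.mul_const (fτ τ (u x))
        have := h3.const_mul c
        convert this using 2
        ring
      refine h2.congr' ?_
      filter_upwards [h1] with n hn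
      rw [hn, one_mul]
  have hrhs : Tendsto (fun n => 72 * π ^ 4 * K * ∑ j, |a j| + C * η n) atTop
      (𝓝 (72 * π ^ 4 * K * ∑ j, |a j|)) := by
    simpa using (hη0.const_mul C).const_add (72 * π ^ 4 * K * ∑ j, |a j|)
  have hfinal := le_of_tendsto_of_tendsto hlim hrhs (by
    filter_upwards [hη0.eventually (gt_mem_nhds hr)] with n hn
    exact hmain (η n) (k n) (hηpos n) hn (hkpos n))
  rw [integral_const_mul, hsum] at hfinal
  have hpi := pi_pos
  have : π / 2 * (∫ x in fund, c * |fτ τ (u x)|) ≤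
      π / 2 * (144 * π ^ 3 * K * (|V.N1| + |V.N2|)) := by
    refine hfinal.trans (le_of_eq ?_)
    ring
  have := le_of_mul_le_mul_left this (by positivity)
  linarith
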